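/- Richness ratio of RoI-feasible strategies (upper bound): for every m ∈ ℕ, every T, every bid history H₋ = (β₋^1,…,β₋^T) and every valuation vector v, sup_{b ∈ 𝒬_{≤m}(H₋)} ∑_{t=1}^{T} V(b;β₋^t) ≤ 2 · max_{b' ∈ 𝒫*_{≤m}} ∑_{t=1}^{T} V(b';β₋^t). -/

import Mathlib

open Finset

namespace Auction

/-- A competing-bid profile for an auction of `K` identical units, represented by the
function sending `j ∈ {1,…,K}` to the `j`-th smallest element of the multiset of the
`K` largest competing bids. -/
structure Profile (K : ℕ) where
  c : ℕ → ℝ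
  mono : ∀ i j : ℕ, 1 ≤ i → i ≤ j → j ≤ K → c i ≤ c j
  nonneg : ∀ j : ℕ, 1 ≤ j → j ≤ K → 0 ≤ c j

/-- A bid vector: `n` units are demanded and `bid j` is the bid for the `j`-th unit
(for `1 ≤ j ≤ n`). -/
structure BidVec where
  n : ℕ
  bid : ℕ → ℝ

/-- A bid vector is valid if its bids are non-increasing and positive. -/
def BidVec.Valid (b : BidVec) : Prop :=
  (∀ i j : ℕ, 1 ≤ i → i ≤ j → j ≤ b.n → b.bid j ≤ b.bid i) ∧
  ∀ j : ℕ, 1 ≤ j → j ≤ b.n → 0 < b.bid j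

open Classical in
/-- The number of units the bidder wins (ties broken in the bidder's favor): the
largest `r ≤ min n K` such that the bidder's `j`-th bid is at least the `j`-th
threshold `β.c j` for every `j ≤ r`. -/
noncomputable def alloc (K : ℕ) (b : BidVec) (β : Profile K) : ℕ :=
  ((Finset.Icc 1 (min b.n K)).filter fun r => ∀ j ∈ Finset.Icc 1 r, β.c j ≤ b.bid j).sup id

/-- The clearing price: the `K`-th highest among all submitted bids (taken to be `0`
when the bidder wins no unit). -/
noncomputable def price (K : ℕ) (b : BidVec) (β : Profile K) : ℝ :=
  if alloc K b β = 0 then 0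
  else if alloc K b β < K then min (b.bid (alloc K b β)) (β.c (alloc K b β + 1))
  else b.bid K

/-- The value obtained by the bidder. -/
noncomputable def value (v : ℕ → ℝ) (K : ℕ) (b : BidVec) (β : Profile K) : ℝ :=
  ∑ j ∈ Finset.Icc 1 (alloc K b β), v j

/-- The bidder's total payment. -/
noncomputable def payment (K : ℕ) (b : BidVec) (β : Profile K) : ℝ :=
  price K b β * (alloc K b β : ℝ)

/-- The RoI constraint (with target RoI `γ = 0`) against a single competing-bid profile. -/
def Feasible (v : ℕ → ℝ) (K : ℕ) (b : BidVec) (β : Profile K) : Prop :=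
  payment K b β ≤ value v K b β

/-- A bid vector is safe if it satisfies the RoI constraint against every profile. -/
def Safe (v : ℕ → ℝ) (K : ℕ) (b : BidVec) : Prop :=
  ∀ β : Profile K, Feasible v K b β

/-- A valuation vector: nonnegative and non-increasing on `{1,…,M}`. -/
def ValidValuation (M : ℕ) (v : ℕ → ℝ) : Prop :=
  (∀ j : ℕ, 1 ≤ j → j ≤ M → 0 ≤ v j) ∧
  ∀ i j : ℕ, 1 ≤ i → i ≤ j → j ≤ M → v j ≤ v i

/-- The average cumulative valuation `w_j = (v_1 + ⋯ + v_j) / j`. -/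
noncomputable def w (v : ℕ → ℝ) (j : ℕ) : ℝ :=
  (∑ ℓ ∈ Finset.Icc 1 j, v ℓ) / (j : ℝ)

/-- An `m`-uniform bidding strategy: bid-quantity pairs `(b j, q j)` for `1 ≤ j ≤ m`. -/
structure Uniform where
  m : ℕ
  b : ℕ → ℝ
  q : ℕ → ℕ

/-- Cumulative quantities `Q j = q 1 + ⋯ + q j`. -/
def Uniform.Q (s : Uniform) (j : ℕ) : ℕ := ∑ ℓ ∈ Finset.Icc 1 j, s.q ℓ

/-- `s` is a genuine `m`-uniform strategy for maximum demand `M`: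
`b 1 > b 2 > ⋯ > b m > 0`, positive quantities, and `Q m ≤ M`. -/
def Uniform.IsUniform (M : ℕ) (s : Uniform) : Prop :=
  1 ≤ s.m ∧
  (∀ j : ℕ, 1 ≤ j → j ≤ s.m → 0 < s.q j) ∧
  0 < s.b s.m ∧
  (∀ j : ℕ, 1 ≤ j → j < s.m → s.b (j + 1) < s.b j) ∧
  s.Q s.m ≤ M

/-- The bid vector associated to a uniform strategy: the bid on the `j`-th unit is
`b ℓ`, where `ℓ` is least with `j ≤ Q ℓ`. -/
noncomputable def Uniform.toBidVec (s : Uniform) : BidVec :=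
  ⟨s.Q s.m, fun j => s.b (sInf {ℓ : ℕ | j ≤ s.Q ℓ})⟩

/-- The 1-uniform strategy bidding `b` on `q` units. -/
def single (b : ℝ) (q : ℕ) : Uniform := ⟨1, fun _ => b, fun _ => q⟩

/-- Membership in the class `𝒫*_{≤ m}` of safe undominated strategies with at most `m`
bid-quantity pairs: strategies determined by a tuple `0 < Q 1 < ⋯ < Q k ≤ M` (`k ≤ m`)
via `b ℓ = w (Q ℓ)` and `q ℓ = Q ℓ - Q (ℓ-1)`. -/
def InSafeClass (M : ℕ) (v : ℕ → ℝ) (m : ℕ) (s : Uniform) : Prop :=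
  1 ≤ s.m ∧ s.m ≤ m ∧ (∀ j : ℕ, 1 ≤ j → j ≤ s.m → 0 < s.q j) ∧ s.Q s.m ≤ M ∧
  ∀ ℓ : ℕ, 1 ≤ ℓ → ℓ ≤ s.m → s.b ℓ = w v (s.Q ℓ)

/-- Membership in the class `𝒬_{≤ m}(H)` of strategies with at most `m` bid-quantity
pairs that are RoI-feasible for the bid history `H` over rounds `1,…,T`. -/
def InFeasClass (M : ℕ) (v : ℕ → ℝ) (K T : ℕ) (H : ℕ → Profile K) (m : ℕ) (s : Uniform) : Prop :=
  s.IsUniform M ∧ s.m ≤ m ∧ ∀ t ∈ Finset.Icc 1 T, Feasible v K s.toBidVec (H t)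

/-- Total value obtained by strategy `s` over the bid history `H` on rounds `1,…,T`. -/
noncomputable def totalValue (v : ℕ → ℝ) (K T : ℕ) (H : ℕ → Profile K) (s : Uniform) : ℝ :=
  ∑ t ∈ Finset.Icc 1 T, value v K s.toBidVec (H t)

/-- The optimal total value over the class `𝒫*_{≤ m}`. -/
noncomputable def bestSafe (M : ℕ) (v : ℕ → ℝ) (K T : ℕ) (H : ℕ → Profile K) (m : ℕ) : ℝ :=
  sSup {x : ℝ | ∃ s : Uniform, InSafeClass M v m s ∧ x = totalValue v K T H s}

/-- The optimal total value over the class `𝒬_{≤ m}(H)`. -/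
noncomputable def bestFeas (M : ℕ) (v : ℕ → ℝ) (K T : ℕ) (H : ℕ → Profile K) (m : ℕ) : ℝ :=
  sSup {x : ℝ | ∃ s : Uniform, InFeasClass M v K T H m s ∧ x = totalValue v K T H s}

/-- The running averages of a non-increasing sequence are non-increasing. -/
theorem w_le_w {M : ℕ} {v : ℕ → ℝ} (hv : ValidValuation M v) {i j : ℕ}
    (hi : 1 ≤ i) (hij : i ≤ j) (hj : j ≤ M) : w v j ≤ w v i := by
  induction j, hij using Nat.le_induction with
  | base => exact le_rfl
  | succ n hin ih =>
    refine le_trans ?_ (ih (by omega))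
    have hsum : (n : ℝ) * v (n + 1) ≤ ∑ ℓ ∈ Finset.Icc 1 n, v ℓ := by
      have h := Finset.card_nsmul_le_sum (Finset.Icc 1 n) v (v (n + 1)) fun x hx => by
        rw [Finset.mem_Icc] at hx
        exact hv.2 x (n + 1) hx.1 (by omega) hj
      simpa using h
    have hn : (0 : ℝ) < n := by exact_mod_cast (by omega : 0 < n)
    unfold w
    rw [Finset.sum_Icc_succ_top (by omega), div_le_div_iff₀ (by positivity) hn]
    push_cast
    nlinarith

theorem Uniform.Q_mono (s : Uniform) : Monotone s.Q := fun _ _ h =>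
  Finset.sum_le_sum_of_subset (Finset.Icc_subset_Icc_right h)

theorem Uniform.Q_zero (s : Uniform) : s.Q 0 = 0 := by simp [Uniform.Q]

theorem alloc_le (K : ℕ) (b : BidVec) (β : Profile K) : alloc K b β ≤ min b.n K := by
  refine Finset.sup_le fun r hr => ?_
  rw [@Finset.mem_filter _ _ (fun _ => Classical.propDecidable _) _ _] at hr
  exact (Finset.mem_Icc.1 hr.1).2

theorem le_alloc {K : ℕ} {b : BidVec} {β : Profile K} {r : ℕ} (hr : r ≤ min b.n K)
    (h : ∀ j, 1 ≤ j → j ≤ r → β.c j ≤ b.bid j) : r ≤ alloc K b β := by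
  rcases Nat.eq_zero_or_pos r with rfl | h0
  · exact Nat.zero_le _
  · refine Finset.le_sup (f := id) ?_
    rw [@Finset.mem_filter _ _ (fun _ => Classical.propDecidable _) _ _]
    refine ⟨Finset.mem_Icc.2 ⟨h0, hr⟩, fun j hj => ?_⟩
    exact h j (Finset.mem_Icc.1 hj).1 (Finset.mem_Icc.1 hj).2

theorem c_le_bid_of_le_alloc {K : ℕ} {b : BidVec} {β : Profile K} {j : ℕ} (hj : 1 ≤ j)
    (h : j ≤ alloc K b β) : β.c j ≤ b.bid j := by
  obtain ⟨r, hr, hjr⟩ := (Finset.le_sup_iff (show (⊥ : ℕ) < j from hj)).1 h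
  rw [@Finset.mem_filter _ _ (fun _ => Classical.propDecidable _) _ _] at hr
  exact hr.2 j (Finset.mem_Icc.2 ⟨hj, hjr⟩)

theorem bid_lt_c_succ_alloc {K : ℕ} {b : BidVec} {β : Profile K}
    (h : alloc K b β < min b.n K) : b.bid (alloc K b β + 1) < β.c (alloc K b β + 1) := by
  by_contra! hc
  have := le_alloc (b := b) (β := β) (r := alloc K b β + 1) h fun j h1 h2 => by
    rcases Nat.lt_or_ge (alloc K b β) j with h3 | h3
    · obtain rfl : j = alloc K b β + 1 := by omega
      exact hc
    · exact c_le_bid_of_le_alloc h1 h3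
  omega

/-- The clearing price is at least the threshold of the last unit won. -/
theorem c_alloc_le_price {K : ℕ} {b : BidVec} {β : Profile K} (h : 1 ≤ alloc K b β) :
    β.c (alloc K b β) ≤ price K b β := by
  have hK := (alloc_le K b β).trans (min_le_right _ _)
  have hb := c_le_bid_of_le_alloc h le_rfl
  unfold price
  rw [if_neg (by omega)]
  split_ifs with hlt
  · exact le_min hb (β.mono _ _ h (by omega) (by omega))
  · rwa [show alloc K b β = K by omega] at hb ⊢

theorem Feasible.price_le_w {v : ℕ → ℝ} {K : ℕ} {b : BidVec} {β : Profile K}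
    (hf : Feasible v K b β) (h : 1 ≤ alloc K b β) : price K b β ≤ w v (alloc K b β) := by
  have h0 : (0 : ℝ) < alloc K b β := by exact_mod_cast h
  exact (le_div_iff₀ h0).2 hf

/-- The value of winning `x` units is monotone in `x`. -/
theorem sum_le_value {M : ℕ} {v : ℕ → ℝ} (hv : ValidValuation M v) {K : ℕ} {b : BidVec}
    (hn : b.n ≤ M) {β : Profile K} {x : ℕ} (hx : x ≤ alloc K b β) :
    ∑ j ∈ Finset.Icc 1 x, v j ≤ value v K b β := by
  refine Finset.sum_le_sum_of_subset_of_nonneg (Finset.Icc_subset_Icc_right hx) fun j hj _ => ?_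
  have := (alloc_le K b β).trans (min_le_left _ _)
  rw [Finset.mem_Icc] at hj
  exact hv.1 j hj.1 (by omega)

theorem value_nonneg {M : ℕ} {v : ℕ → ℝ} (hv : ValidValuation M v) {K : ℕ} {b : BidVec}
    (hn : b.n ≤ M) (β : Profile K) : 0 ≤ value v K b β := by
  simpa using sum_le_value hv hn (β := β) (Nat.zero_le _)

theorem value_le_sum {M : ℕ} {v : ℕ → ℝ} (hv : ValidValuation M v) {K : ℕ} {b : BidVec}
    (hn : b.n ≤ M) (β : Profile K) : value v K b β ≤ ∑ j ∈ Finset.Icc 1 M, v j := by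
  have h := (alloc_le K b β).trans (min_le_left _ _)
  refine Finset.sum_le_sum_of_subset_of_nonneg
    (Finset.Icc_subset_Icc_right (by omega)) fun j hj _ => ?_
  rw [Finset.mem_Icc] at hj
  exact hv.1 j hj.1 hj.2

/-- The safe strategy whose cumulative quantities are the elements of `S`. -/
noncomputable def safeOf (v : ℕ → ℝ) (S : Finset ℕ) : Uniform where
  m := S.card
  b := fun ℓ => w v (∑ i ∈ Finset.Icc 1 ℓ, (Nat.nth (· ∈ S) (i - 1) -
    if i = 1 then 0 else Nat.nth (· ∈ S) (i - 2)))
  q := fun i => Nat.nth (· ∈ S) (i - 1) - if i = 1 then 0 else Nat.nth (· ∈ S) (i - 2)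

theorem nth_mem_lt_nth_mem (S : Finset ℕ) {i j : ℕ} (hij : i < j) (hj : j < S.card) :
    Nat.nth (· ∈ S) i < Nat.nth (· ∈ S) j :=
  Nat.nth_lt_nth_of_lt_card (S.finite_toSet) hij (by simpa using hj)

theorem safeOf_Q_succ (v : ℕ → ℝ) (S : Finset ℕ) {ℓ : ℕ} (hℓ : ℓ < S.card) :
    (safeOf v S).Q (ℓ + 1) = Nat.nth (· ∈ S) ℓ := by
  induction ℓ with
  | zero => simp [Uniform.Q, safeOf]
  | succ n ih =>
    have hlt := nth_mem_lt_nth_mem S (show n < n + 1 by omega) hℓ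
    have ih' := ih (by omega)
    unfold Uniform.Q at ih' ⊢
    rw [Finset.sum_Icc_succ_top (by omega), ih']
    simp only [safeOf, Nat.add_sub_cancel]
    rw [if_neg (by omega), show n + 1 + 1 - 2 = n by omega]
    omega

theorem exists_safeOf_Q_eq (v : ℕ → ℝ) {S : Finset ℕ} {y : ℕ} (hy : y ∈ S) :
    ∃ ℓ ≤ S.card, (safeOf v S).Q ℓ = y := by
  obtain ⟨n, hn, rfl⟩ := Nat.exists_lt_card_finite_nth_eq (p := (· ∈ S)) S.finite_toSet hy
  have hn' : n < S.card := by simpa using hn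
  exact ⟨n + 1, hn', safeOf_Q_succ v S hn'⟩

theorem nth_mem_mem (S : Finset ℕ) {i : ℕ} (hi : i < S.card) : Nat.nth (· ∈ S) i ∈ S :=
  Nat.nth_mem_of_lt_card (p := (· ∈ S)) S.finite_toSet (by simpa using hi)

theorem safeOf_inSafeClass {M m : ℕ} (v : ℕ → ℝ) {S : Finset ℕ} (hne : S.Nonempty)
    (hS : S ⊆ Finset.Icc 1 M) (hc : S.card ≤ m) : InSafeClass M v m (safeOf v S) := by
  have hpos := hne.card_pos
  refine ⟨hpos, hc, fun j h1 h2 => ?_, ?_, fun _ _ _ => rfl⟩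
  · change j ≤ S.card at h2
    rcases Nat.eq_or_lt_of_le h1 with rfl | h3
    · have := Finset.mem_Icc.1 (hS (nth_mem_mem S hpos))
      simp only [safeOf]
      simpa using Nat.lt_of_succ_le this.1
    · have := nth_mem_lt_nth_mem S (show j - 2 < j - 1 by omega) (by omega)
      simp only [safeOf]
      rw [if_neg (by omega)]
      omega
  · have h := safeOf_Q_succ v S (ℓ := S.card - 1) (by omega)
    rw [Nat.sub_add_cancel hpos] at h
    change (safeOf v S).Q S.card ≤ M
    rw [h]
    exact (Finset.mem_Icc.1 (hS (nth_mem_mem S (by omega)))).2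

/-- A safe strategy with breakpoint `y` wins at least `x ≤ y` units whenever the threshold of
unit `x` is at most `w y`. -/
theorem le_alloc_safeOf {K M : ℕ} (hMK : M ≤ K) {v : ℕ → ℝ} (hv : ValidValuation M v)
    {S : Finset ℕ} (hS : S ⊆ Finset.Icc 1 M) {β : Profile K} {x y : ℕ} (hy : y ∈ S)
    (hxy : x ≤ y) (hc : β.c x ≤ w v y) : x ≤ alloc K (safeOf v S).toBidVec β := by
  obtain ⟨ℓ, hℓ, hQ⟩ := exists_safeOf_Q_eq v hy
  have hyM := (Finset.mem_Icc.1 (hS hy)).2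
  have hn : y ≤ (safeOf v S).toBidVec.n := hQ ▸ (safeOf v S).Q_mono hℓ
  refine le_alloc (le_min (by omega) (by omega)) fun j h1 h2 => ?_
  refine (β.mono j x h1 h2 (by omega)).trans (hc.trans ?_)
  have hmem : ℓ ∈ {ℓ : ℕ | j ≤ (safeOf v S).Q ℓ} := by
    simp only [Set.mem_ofPred_eq]; omega
  have hj : j ≤ (safeOf v S).Q (sInf {ℓ : ℕ | j ≤ (safeOf v S).Q ℓ}) := Nat.sInf_mem ⟨ℓ, hmem⟩
  exact w_le_w hv (h1.trans hj) (hQ ▸ (safeOf v S).Q_mono (Nat.sInf_le hmem)) hyM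

/-- If the bidder wins only part of the units of a bid-quantity pair, then the clearing price is
the bid of that pair. -/
theorem price_eq_bid {K : ℕ} {s : Uniform} (hK : s.Q s.m ≤ K) {β : Profile K}
    (h : 1 ≤ alloc K s.toBidVec β)
    (hne : alloc K s.toBidVec β ≠ s.Q (sInf {ℓ : ℕ | alloc K s.toBidVec β ≤ s.Q ℓ})) :
    price K s.toBidVec β = s.toBidVec.bid (alloc K s.toBidVec β) := by
  set x := alloc K s.toBidVec β with hx
  have hxn : x ≤ s.Q s.m := (alloc_le K s.toBidVec β).trans (min_le_left _ _)
  have hle : x ≤ s.Q (sInf {ℓ : ℕ | x ≤ s.Q ℓ}) :=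
    Nat.sInf_mem (s := {ℓ : ℕ | x ≤ s.Q ℓ}) ⟨s.m, hxn⟩
  have hmono := s.Q_mono (Nat.sInf_le (s := {ℓ : ℕ | x ≤ s.Q ℓ}) hxn)
  have heq : sInf {ℓ : ℕ | x + 1 ≤ s.Q ℓ} = sInf {ℓ : ℕ | x ≤ s.Q ℓ} := by
    have hmem : sInf {ℓ : ℕ | x ≤ s.Q ℓ} ∈ {ℓ : ℕ | x + 1 ≤ s.Q ℓ} := by
      simp only [Set.mem_ofPred_eq]; omega
    refine le_antisymm (Nat.sInf_le hmem) (Nat.sInf_le ?_)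
    have : x + 1 ≤ s.Q (sInf {ℓ : ℕ | x + 1 ≤ s.Q ℓ}) := Nat.sInf_mem ⟨_, hmem⟩
    simp only [Set.mem_ofPred_eq]; omega
  have hlt : s.toBidVec.bid (x + 1) < β.c (x + 1) :=
    bid_lt_c_succ_alloc (lt_min (show x < s.Q s.m by omega) (by omega))
  have hbid : s.toBidVec.bid (x + 1) = s.toBidVec.bid x := congrArg s.b heq
  unfold price
  rw [← hx, if_neg (by omega), if_pos (by omega), min_eq_left (by linarith)]

/-- A feasible strategy is covered, round by round, by two safe strategies. -/
theorem exists_cover {K M T : ℕ} {v : ℕ → ℝ} (hv : ValidValuation M v) (hMK : M ≤ K)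
    {m : ℕ} {H : ℕ → Profile K} {s : Uniform} (hs : InFeasClass M v K T H m s) :
    ∃ a b : Uniform, InSafeClass M v m a ∧ InSafeClass M v m b ∧
      totalValue v K T H s ≤ totalValue v K T H a + totalValue v K T H b := by
  classical
  obtain ⟨⟨hm1, hq, -, -, hQM⟩, hmm, hf⟩ := hs
  set x : ℕ → ℕ := fun t => alloc K s.toBidVec (H t) with hx
  set seg : ℕ → ℕ := fun t => sInf {ℓ : ℕ | x t ≤ s.Q ℓ} with hseg
  set B : Finset ℕ := (Finset.Icc 1 T).filter
    fun t => 1 ≤ x t ∧ s.toBidVec.bid (x t) ≤ w v (x t) with hB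
  set X : ℕ → ℕ := fun ℓ => max 1 ((B.filter fun t => seg t = ℓ).sup x) with hX
  have hxQ : ∀ t, x t ≤ s.Q s.m := fun t =>
    (alloc_le K s.toBidVec (H t)).trans (min_le_left _ _)
  have hsegmem : ∀ t, 1 ≤ x t → seg t ∈ Finset.Icc 1 s.m := fun t ht => by
    have h1 : x t ≤ s.Q (seg t) := Nat.sInf_mem (s := {ℓ : ℕ | x t ≤ s.Q ℓ}) ⟨s.m, hxQ t⟩
    have h2 : seg t ≤ s.m := Nat.sInf_le (hxQ t)
    refine Finset.mem_Icc.2 ⟨Nat.one_le_iff_ne_zero.2 fun h0 => ?_, h2⟩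
    rw [h0, s.Q_zero] at h1
    omega
  have hQpos : ∀ ℓ, 1 ≤ ℓ → 1 ≤ s.Q ℓ := fun ℓ hℓ => by
    refine le_trans ?_ (s.Q_mono hℓ)
    simpa [Uniform.Q] using Nat.succ_le_of_lt (hq 1 le_rfl hm1)
  have hI : (Finset.Icc 1 s.m).Nonempty := ⟨1, Finset.mem_Icc.2 ⟨le_rfl, hm1⟩⟩
  have hA_sub : (Finset.Icc 1 s.m).image s.Q ⊆ Finset.Icc 1 M := by
    refine Finset.image_subset_iff.2 fun ℓ hℓ => ?_
    rw [Finset.mem_Icc] at hℓ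
    exact Finset.mem_Icc.2 ⟨hQpos ℓ hℓ.1, (s.Q_mono hℓ.2).trans hQM⟩
  have hB_sub : (Finset.Icc 1 s.m).image X ⊆ Finset.Icc 1 M := by
    refine Finset.image_subset_iff.2 fun ℓ _ => Finset.mem_Icc.2 ⟨le_max_left _ _, ?_⟩
    exact max_le ((hQpos s.m hm1).trans hQM) (Finset.sup_le fun t _ => (hxQ t).trans hQM)
  have hcard : ∀ f : ℕ → ℕ, ((Finset.Icc 1 s.m).image f).card ≤ m := fun f =>
    Finset.card_image_le.trans (by simpa using hmm)
  have hA := safeOf_inSafeClass v (hI.image s.Q) hA_sub (hcard _)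
  have hB' := safeOf_inSafeClass v (hI.image X) hB_sub (hcard _)
  refine ⟨_, _, hA, hB', ?_⟩
  unfold totalValue
  rw [← Finset.sum_add_distrib]
  refine Finset.sum_le_sum fun t ht => ?_
  have hA0 := value_nonneg hv hA.2.2.2.1 (b := (safeOf v _).toBidVec) (H t)
  have hB0 := value_nonneg hv hB'.2.2.2.1 (b := (safeOf v _).toBidVec) (H t)
  rcases Nat.eq_zero_or_pos (x t) with h0 | hpos
  · have : value v K s.toBidVec (H t) = 0 := by
      unfold value
      rw [show alloc K s.toBidVec (H t) = 0 from h0]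
      simp
    linarith
  have hfw := (hf t ht).price_le_w hpos
  by_cases htB : t ∈ B
  · have hmem : t ∈ B.filter fun t' => seg t' = seg t := Finset.mem_filter.2 ⟨htB, rfl⟩
    obtain ⟨u, hu, hue⟩ := Finset.exists_mem_eq_sup _ ⟨t, hmem⟩ x
    rw [Finset.mem_filter] at hu
    obtain ⟨-, hu1, hu2⟩ := Finset.mem_filter.1 hu.1
    have hXu : X (seg t) = x u := by
      simp only [hX]
      rw [hue]
      exact max_eq_right hu1
    have hxu : x t ≤ x u := hue ▸ Finset.le_sup (f := x) hmem
    have hbid : s.toBidVec.bid (x t) = s.toBidVec.bid (x u) := congrArg s.b hu.2.symm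
    have hle : x t ≤ alloc K (safeOf v ((Finset.Icc 1 s.m).image X)).toBidVec (H t) :=
      le_alloc_safeOf hMK hv hB_sub (Finset.mem_image_of_mem X (hsegmem t hpos))
        (hXu ▸ hxu) (by
          rw [hXu]
          exact (c_le_bid_of_le_alloc hpos le_rfl).trans (hbid.le.trans hu2))
    have : value v K s.toBidVec (H t) ≤ _ := sum_le_value hv hB'.2.2.2.1 hle
    linarith
  · have hend : x t = s.Q (seg t) := by
      by_contra hne
      have hp := price_eq_bid (hQM.trans hMK) hpos hne
      exact htB (Finset.mem_filter.2 ⟨ht, hpos, hp ▸ hfw⟩)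
    have hle : x t ≤ alloc K (safeOf v ((Finset.Icc 1 s.m).image s.Q)).toBidVec (H t) :=
      le_alloc_safeOf hMK hv hA_sub (Finset.mem_image_of_mem s.Q (hsegmem t hpos))
        hend.le (hend ▸ (c_alloc_le_price hpos).trans hfw)
    have : value v K s.toBidVec (H t) ≤ _ := sum_le_value hv hA.2.2.2.1 hle
    linarith

theorem totalValue_le_bestSafe {K M T : ℕ} {v : ℕ → ℝ} (hv : ValidValuation M v)
    {m : ℕ} {H : ℕ → Profile K} {s : Uniform} (hs : InSafeClass M v m s) :
    totalValue v K T H s ≤ bestSafe M v K T H m := by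
  refine le_csSup ⟨∑ _t ∈ Finset.Icc 1 T, ∑ j ∈ Finset.Icc 1 M, v j, ?_⟩ ⟨s, hs, rfl⟩
  rintro _ ⟨s', hs', rfl⟩
  exact Finset.sum_le_sum fun t _ => value_le_sum hv hs'.2.2.2.1 (H t)

theorem bestSafe_nonneg {K M T : ℕ} {v : ℕ → ℝ} (hv : ValidValuation M v)
    {m : ℕ} {H : ℕ → Profile K} : 0 ≤ bestSafe M v K T H m := by
  refine Real.sSup_nonneg ?_
  rintro _ ⟨s, hs, rfl⟩
  exact Finset.sum_nonneg fun t _ => value_nonneg hv hs.2.2.2.1 (H t)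

/-- Theorem `thm:Price_universal`, upper bound: for every bid history
and valuation vector, the optimal value over the RoI-feasible strategies with at most
`m` bid-quantity pairs is at most twice the optimal value over the safe undominated
strategies with at most `m` bid-quantity pairs. -/
theorem richness_feasible_upper
    (K M T : ℕ) (v : ℕ → ℝ) (hv : ValidValuation M v) (hMK : M ≤ K)
    (m : ℕ) (hm : 1 ≤ m) (H : ℕ → Profile K) :
    bestFeas M v K T H m ≤ 2 * bestSafe M v K T H m := by
  refine Real.sSup_le ?_ (mul_nonneg zero_le_two (bestSafe_nonneg hv))
  rintro _ ⟨s, hs, rfl⟩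
  obtain ⟨a, b, ha, hb, hle⟩ := exists_cover hv hMK hs
  have h1 := totalValue_le_bestSafe (T := T) (H := H) hv ha
  have h2 := totalValue_le_bestSafe (T := T) (H := H) hv hb
  linarith

end Auction
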